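/- Let D be a k-ary dependency that is domain independent, strongly first order and union closed, and suppose that (A, R) ∈ D. Then there exists some U-sentence χ(R) over the signature {R} such that: (1) (A, R) ⊨ χ(R); and (2) every model (B, S) with (B, S) ⊨ χ(R) satisfies (B, S) ∈ D. -/

import Mathlib

open FirstOrder FirstOrder.Language

/-- A `k`-ary dependency: an isomorphism-closed class of models `(A, R)` where `R` is a
`k`-ary relation on the domain `A`. -/
structure Dependency (k : ℕ) : Type 1 where
  Mem : ∀ (A : Type), Set (Fin k → A) → Prop
  iso_closed : ∀ {A B : Type} (e : A ≃ B) (R : Set (Fin k → A)),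
    Mem A R → Mem B ((fun (t : Fin k → A) (i : Fin k) => e (t i)) '' R)

/-- `Fld R` is the set of all elements occurring in some position of some tuple of `R`. -/
def Fld {k : ℕ} {A : Type} (R : Set (Fin k → A)) : Set A :=
  {a | ∃ t ∈ R, ∃ i, t i = a}

/-- A dependency is domain independent if `(A, R) ∈ D ↔ (Fld R, R) ∈ D`. -/
def Dependency.DomainIndependent {k : ℕ} (D : Dependency k) : Prop :=
  ∀ (A : Type) (R : Set (Fin k → A)),
    D.Mem A R ↔ D.Mem (Fld R) {t : Fin k → (Fld R) | (fun i => (t i : A)) ∈ R}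

/-- A dependency is union closed if it is closed under unions of arbitrary
(possibly empty) families of relations on a fixed domain. -/
def Dependency.UnionClosed {k : ℕ} (D : Dependency k) : Prop :=
  ∀ (A : Type) (I : Type) (R : I → Set (Fin k → A)),
    (∀ i, D.Mem A (R i)) → D.Mem A (⋃ i, R i)

def Dependency.DownwardsClosed {k : ℕ} (D : Dependency k) : Prop :=
  ∀ (A : Type) (R S : Set (Fin k → A)), D.Mem A R → S ⊆ R → D.Mem A S

def Dependency.UpwardsClosed {k : ℕ} (D : Dependency k) : Prop :=
  ∀ (A : Type) (R S : Set (Fin k → A)), D.Mem A R → R ⊆ S → D.Mem A S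

def Dependency.EmptyTeamProperty {k : ℕ} (D : Dependency k) : Prop :=
  ∀ A : Type, D.Mem A (∅ : Set (Fin k → A))

/-- `teamMap X xs` is `X(x⃗)`: the set of values of the tuple of variables `xs` over the team `X`. -/
def teamMap {M : Type} (X : Set (ℕ → M)) {n : ℕ} (xs : Fin n → ℕ) : Set (Fin n → M) :=
  {t | ∃ s ∈ X, t = fun j => s (xs j)}

/-- Formulas of `FO(𝒟)` in negation normal form, over the language `L`, with variables in `ℕ`,
where `𝒟` is the family of dependencies `(Ds i)_{i : ι}`. -/
inductive TSFormula (L : FirstOrder.Language.{0,0}) {ι : Type} (Ds : ι → (k : ℕ) × Dependency k) : Type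
  | rel {n : ℕ} (r : L.Relations n) (ts : Fin n → L.Term ℕ)
  | nrel {n : ℕ} (r : L.Relations n) (ts : Fin n → L.Term ℕ)
  | equal (t₁ t₂ : L.Term ℕ)
  | nequal (t₁ t₂ : L.Term ℕ)
  | depAtom (i : ι) (xs : Fin (Ds i).1 → ℕ)
  | conj (φ ψ : TSFormula L Ds)
  | disj (φ ψ : TSFormula L Ds)
  | ex (v : ℕ) (φ : TSFormula L Ds)
  | fa (v : ℕ) (φ : TSFormula L Ds)

variable {L : FirstOrder.Language.{0,0}} {ι : Type} {Ds : ι → (k : ℕ) × Dependency k}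

/-- Team semantics for `FO(𝒟)`. -/
def TSFormula.Sat (M : Type) [L.Structure M] : TSFormula L Ds → Set (ℕ → M) → Prop
  | .rel r ts, X => ∀ s ∈ X, Structure.RelMap r (fun i => (ts i).realize s)
  | .nrel r ts, X => ∀ s ∈ X, ¬ Structure.RelMap r (fun i => (ts i).realize s)
  | .equal t₁ t₂, X => ∀ s ∈ X, t₁.realize s = t₂.realize s
  | .nequal t₁ t₂, X => ∀ s ∈ X, t₁.realize s ≠ t₂.realize s
  | .depAtom i xs, X => (Ds i).2.Mem M (teamMap X xs)
  | .conj φ ψ, X => φ.Sat M X ∧ ψ.Sat M X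
  | .disj φ ψ, X => ∃ Y Z : Set (ℕ → M), X = Y ∪ Z ∧ φ.Sat M Y ∧ ψ.Sat M Z
  | .ex v φ, X => ∃ H : (ℕ → M) → Set M, (∀ s ∈ X, (H s).Nonempty) ∧
      φ.Sat M {s' | ∃ s ∈ X, ∃ m ∈ H s, s' = Function.update s v m}
  | .fa v φ, X => φ.Sat M {s' | ∃ s ∈ X, ∃ m : M, s' = Function.update s v m}

/-- The set of variables of a first-order term. -/
def termVars : L.Term ℕ → Set ℕ
  | .var x => {x}
  | .func _f ts => ⋃ i, termVars (ts i)

/-- The free variables of a team-semantics formula. -/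
def TSFormula.freeVars : TSFormula L Ds → Set ℕ
  | .rel _ ts => ⋃ i, termVars (ts i)
  | .nrel _ ts => ⋃ i, termVars (ts i)
  | .equal t₁ t₂ => termVars t₁ ∪ termVars t₂
  | .nequal t₁ t₂ => termVars t₁ ∪ termVars t₂
  | .depAtom _ xs => Set.range xs
  | .conj φ ψ => φ.freeVars ∪ ψ.freeVars
  | .disj φ ψ => φ.freeVars ∪ ψ.freeVars
  | .ex v φ => φ.freeVars \ {v}
  | .fa v φ => φ.freeVars \ {v}

/-- A sentence of `FO(𝒟)` is true in `M` iff it is satisfied by the team containing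
only one assignment (for sentences, the choice of assignment is irrelevant). -/
def TSFormula.TrueIn (M : Type) [L.Structure M] (φ : TSFormula L Ds) : Prop :=
  ∀ s : ℕ → M, φ.Sat M {s}

/-- A family of dependencies is strongly first order iff every sentence of `FO(𝒟)`,
over any (Type-0) signature, is equivalent to some first-order sentence. -/
def StronglyFirstOrderFamily {ι : Type} (Ds : ι → (k : ℕ) × Dependency k) : Prop :=
  ∀ (L : FirstOrder.Language.{0,0}) (φ : TSFormula L Ds), φ.freeVars = ∅ →
    ∃ ψ : L.Sentence, ∀ (M : Type) [L.Structure M] [Nonempty M],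
      (φ.TrueIn M ↔ Sentence.Realize M ψ)

/-- A single dependency is strongly first order iff every sentence of `FO(D)`
is equivalent to some first-order sentence. -/
def StronglyFirstOrder {k : ℕ} (D : Dependency k) : Prop :=
  StronglyFirstOrderFamily (fun _ : Unit => ⟨k, D⟩)

/-- The signature `{a₁, …, a_c}` consisting of `c` constant symbols (and no relations
other than equality). -/
def constLang (c : ℕ) : FirstOrder.Language.{0,0} where
  Functions := fun n => match n with
    | 0 => Fin c
    | _ + 1 => Empty
  Relations := fun _ => Empty

/-- The `{a⃗}`-structure on `A` interpreting the constants as `cs`. -/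
def constStructure {c : ℕ} (A : Type) (cs : Fin c → A) : (constLang c).Structure A where
  funMap := fun {n} f _ => match n, f with
    | 0, i => cs i
    | _ + 1, f => f.elim
  RelMap := fun {_} r => r.elim

/-- Since the signature `{R, a⃗}` has no function symbols of positive arity, every term over it
is a variable or a constant; a term with variables among `x⃗ = (x₁ … x_m)` is an element of
`Fin m ⊕ Fin c`. Its evaluation under `x : Fin m → A` and constants `cs : Fin c → A` is
`Sum.elim x cs`. A literal over `{R, a⃗}` with variables among `x⃗` in which `R` occurs only
positively is an equality, an inequality, or a positive `R`-atom. -/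
inductive ULit (k c m : ℕ) : Type
  | eq (t₁ t₂ : Fin m ⊕ Fin c)
  | ne (t₁ t₂ : Fin m ⊕ Fin c)
  | rel (ts : Fin k → (Fin m ⊕ Fin c))

/-- Realization of a literal in the model `(A, R, cs)` under the assignment `x` to `x⃗`. -/
def ULit.Realize {k c m : ℕ} {A : Type} (R : Set (Fin k → A)) (cs : Fin c → A)
    (x : Fin m → A) : ULit k c m → Prop
  | .eq t₁ t₂ => Sum.elim x cs t₁ = Sum.elim x cs t₂
  | .ne t₁ t₂ => Sum.elim x cs t₁ ≠ Sum.elim x cs t₂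
  | .rel ts => (fun j => Sum.elim x cs (ts j)) ∈ R

/-- A U-sentence over the signature `{R, a⃗}`: a sentence of the form
`∃x⃗(η(x⃗) ∧ ∀y⃗(R y⃗ → θ(x⃗, y⃗)))`, where `η` is a conjunction of literals in which `R` occurs
only positively and `θ` is a first-order formula over `{a⃗}` (in which `R` does not occur)
with free variables among the disjoint tuples `x⃗` (of length `m`) and `y⃗` (of length `k`). -/
structure USentence (k c : ℕ) : Type where
  m : ℕ
  η : List (ULit k c m)
  θ : (constLang c).Formula ((Fin m) ⊕ (Fin k))

/-- Realization of a U-sentence in the model `(A, R, cs)`. -/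
def USentence.Realize {k c : ℕ} (A : Type) (R : Set (Fin k → A)) (cs : Fin c → A)
    (χ : USentence k c) : Prop :=
  letI := constStructure A cs
  ∃ x : Fin χ.m → A,
    (∀ l ∈ χ.η, ULit.Realize R cs x l) ∧
    ∀ y ∈ R, χ.θ.Realize (Sum.elim x y)

/-- The image of a relation under a map between domains. -/
def relImage {k : ℕ} {A B : Type} (h : A → B) (R : Set (Fin k → A)) : Set (Fin k → B) :=
  (fun t i => h (t i)) '' R

theorem relImage_relImage {k : ℕ} {A B C : Type} (h : A → B) (g : B → C)
    (R : Set (Fin k → A)) : relImage g (relImage h R) = relImage (fun a => g (h a)) R := by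
  simp [relImage, Set.image_image]

theorem relImage_mono {k : ℕ} {A B : Type} (h : A → B) {R S : Set (Fin k → A)} (hRS : R ⊆ S) :
    relImage h R ⊆ relImage h S :=
  Set.image_mono hRS

theorem relImage_id {k : ℕ} {A : Type} (R : Set (Fin k → A)) :
    relImage (fun a => a) R = R := by
  simp [relImage]

namespace Dependency

variable {k : ℕ} {D : Dependency k}

theorem mem_relImage_equiv {A B : Type} (e : A ≃ B) (R : Set (Fin k → A)) :
    D.Mem B (relImage e R) ↔ D.Mem A R := by
  refine ⟨fun h => ?_, D.iso_closed e R⟩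
  have h' := D.iso_closed e.symm _ h
  change D.Mem A (relImage e.symm (relImage e R)) at h'
  simpa [relImage_relImage, relImage_id] using h'

theorem DomainIndependent.mem_relImage (hdi : D.DomainIndependent) {A B : Type} {h : A → B}
    (hh : Function.Injective h) (R : Set (Fin k → A)) :
    D.Mem B (relImage h R) ↔ D.Mem A R := by
  rw [hdi A R, hdi B (relImage h R)]
  have hmem : ∀ a : A, a ∈ Fld R → h a ∈ Fld (relImage h R) := by
    rintro a ⟨t, ht, i, rfl⟩
    exact ⟨_, ⟨t, ht, rfl⟩, i, rfl⟩
  let e : Fld R ≃ Fld (relImage h R) := Equiv.ofBijective (fun a => ⟨h a, hmem a a.2⟩) <| by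
    constructor
    · intro a b hab
      exact Subtype.ext (hh (congrArg Subtype.val hab))
    · rintro ⟨_, _, ⟨t, ht, rfl⟩, i, rfl⟩
      exact ⟨⟨t i, t, ht, i, rfl⟩, rfl⟩
  rw [← mem_relImage_equiv e]
  have hset : {t : Fin k → Fld (relImage h R) | (fun i => (t i : B)) ∈ relImage h R} =
      relImage e {t : Fin k → Fld R | (fun i => (t i : A)) ∈ R} := by
    ext t
    constructor
    · rintro ⟨r, hr, hrt⟩
      refine ⟨fun i => ⟨r i, r, hr, i, rfl⟩, hr, ?_⟩
      funext i
      exact Subtype.ext (congrFun hrt i)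
    · rintro ⟨r, hr, rfl⟩
      exact ⟨_, hr, rfl⟩
  rw [hset]

/-- Membership in a domain independent dependency of an image of a relation only depends on the
kernel of the map. -/
theorem DomainIndependent.mem_relImage_congr (hdi : D.DomainIndependent) {X A B : Type}
    {u : X → A} {v : X → B} (huv : ∀ x y, u x = u y ↔ v x = v y) (T : Set (Fin k → X)) :
    D.Mem A (relImage u T) ↔ D.Mem B (relImage v T) := by
  let u' : Quotient (Setoid.ker u) → A := Quotient.lift u fun _ _ h => h
  let v' : Quotient (Setoid.ker u) → B := Quotient.lift v fun x y h => (huv x y).1 h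
  have hu : Function.Injective u' := by
    rintro ⟨x⟩ ⟨y⟩ h
    exact Quotient.sound h
  have hv : Function.Injective v' := by
    rintro ⟨x⟩ ⟨y⟩ h
    exact Quotient.sound ((huv x y).2 h)
  let q : X → Quotient (Setoid.ker u) := fun x => Quotient.mk _ x
  have h1 : relImage u T = relImage u' (relImage q T) := by
    rw [relImage_relImage]; rfl
  have h2 : relImage v T = relImage v' (relImage q T) := by
    rw [relImage_relImage]; rfl
  rw [h1, h2, hdi.mem_relImage hu, hdi.mem_relImage hv]

/-- Adjoining a tuple `s` to the image of `R` in one extension or a tuple `t` to the image of `R`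
in another is the same for `D` when `s` and `t` have the same equality type over the domain
of `R`. -/
theorem DomainIndependent.mem_insert_congr (hdi : D.DomainIndependent) {A B C : Type}
    {g : A → B} {h : A → C} (hg : Function.Injective g) (hh : Function.Injective h)
    {s : Fin k → B} {t : Fin k → C} (hst : ∀ i a, s i = g a ↔ t i = h a)
    (hss : ∀ i j, s i = s j ↔ t i = t j) (R : Set (Fin k → A)) :
    D.Mem B (insert s (relImage g R)) ↔ D.Mem C (insert t (relImage h R)) := by
  let T : Set (Fin k → A ⊕ Fin k) := insert Sum.inr (relImage Sum.inl R)
  have h1 : relImage (Sum.elim g s) T = insert s (relImage g R) := by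
    simp only [T, relImage, Set.image_insert_eq, Set.image_image, Sum.elim_inr, Sum.elim_inl]
  have h2 : relImage (Sum.elim h t) T = insert t (relImage h R) := by
    simp only [T, relImage, Set.image_insert_eq, Set.image_image, Sum.elim_inr, Sum.elim_inl]
  rw [← h1, ← h2]
  apply hdi.mem_relImage_congr
  rintro (a | i) (b | j)
  · simp [hg.eq_iff, hh.eq_iff]
  · simp only [Sum.elim_inl, Sum.elim_inr]
    rw [eq_comm, hst, eq_comm]
  · simp only [Sum.elim_inl, Sum.elim_inr]
    rw [hst]
  · simp only [Sum.elim_inr]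
    rw [hss]

theorem UnionClosed.mem_of_forall_exists (huc : D.UnionClosed) {A : Type} {S : Set (Fin k → A)}
    (h : ∀ s ∈ S, ∃ R, R ⊆ S ∧ s ∈ R ∧ D.Mem A R) : D.Mem A S := by
  choose! F hF using h
  have := huc A S (fun s => F s) fun s => (hF s s.2).2.2
  convert this
  ext x
  simp only [Set.mem_iUnion]
  exact ⟨fun hx => ⟨⟨x, hx⟩, (hF x hx).2.1⟩, fun ⟨s, hs⟩ => (hF s s.2).1 hs⟩

end Dependency

/-- The ultraproduct of a family of types. -/
abbrev Ultra {α : Type} (U : Ultrafilter α) (M : α → Type) : Type :=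
  (U : Filter α).Product M

namespace Ultra

variable {α : Type} {U : Ultrafilter α} {M : α → Type}

/-- The class of a family of elements in the ultraproduct. -/
def mk (U : Ultrafilter α) (f : ∀ a, M a) : Ultra U M :=
  @Quotient.mk' _ (Filter.productSetoid (U : Filter α) M) f

theorem mk_eq_mk {f g : ∀ a, M a} : mk U f = mk U g ↔ ∀ᶠ a in U, f a = g a :=
  Quotient.eq''

theorem mk_surjective : Function.Surjective (mk U : (∀ a, M a) → Ultra U M) :=
  @Quotient.mk'_surjective _ (Filter.productSetoid (U : Filter α) M)

/-- A family of elements representing an element of the ultraproduct. -/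
noncomputable def rep (x : Ultra U M) : ∀ a, M a :=
  Function.surjInv mk_surjective x

@[simp]
theorem mk_rep (x : Ultra U M) : mk U x.rep = x :=
  Function.surjInv_eq mk_surjective x

/-- The ultraproduct of a family of relations. -/
def rel {k : ℕ} (U : Ultrafilter α) (R : ∀ a, Set (Fin k → M a)) : Set (Fin k → Ultra U M) :=
  {t | ∀ᶠ a in U, (fun i => (t i).rep a) ∈ R a}

theorem mk_mem_rel {k : ℕ} {R : ∀ a, Set (Fin k → M a)} {f : Fin k → ∀ a, M a} :
    (fun i => mk U (f i)) ∈ rel U R ↔ ∀ᶠ a in U, (fun i => f i a) ∈ R a := by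
  have h : ∀ᶠ a in U, ∀ i, (mk U (f i)).rep a = f i a :=
    Filter.eventually_all.2 fun i => mk_eq_mk.1 (mk_rep _)
  refine Filter.eventually_congr (h.mono fun a ha => ?_)
  simp only [ha]

theorem exists_rep_tuple {k : ℕ} (t : Fin k → Ultra U M) :
    ∃ f : Fin k → ∀ a, M a, t = fun i => mk U (f i) :=
  ⟨fun i => (t i).rep, by simp⟩

end Ultra

/-- The symbols of a signature with a single relation symbol, of arity `n`. -/
inductive RelSymbol (n : ℕ) : ℕ → Type
  | rel : RelSymbol n n

/-- The signature with a single relation symbol, of arity `n`. -/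
def relLang (n : ℕ) : FirstOrder.Language.{0, 0} where
  Functions := fun _ => Empty
  Relations := RelSymbol n

/-- A relation seen as a structure. -/
@[reducible]
def relStructure {n : ℕ} {A : Type} (T : Set (Fin n → A)) : (relLang n).Structure A where
  funMap := fun f _ => nomatch f
  RelMap := fun {_} r x => match r, x with
    | .rel, x => x ∈ T

theorem Ultra.realize_rel {α : Type} {U : Ultrafilter α} {M : α → Type} [∀ a, Nonempty (M a)]
    {n : ℕ} (T : ∀ a, Set (Fin n → M a)) (ψ : (relLang n).Sentence) :
    (letI := relStructure (Ultra.rel U T); Sentence.Realize (Ultra U M) ψ) ↔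
      ∀ᶠ a in U, (letI := relStructure (T a); Sentence.Realize (M a) ψ) := by
  let _ : ∀ a, (relLang n).Structure (M a) := fun a => relStructure (T a)
  have h : relStructure (Ultra.rel U T) = Ultraproduct.structure := by
    ext m r x
    · exact r.elim
    · cases r
      obtain ⟨f, rfl⟩ := Ultra.exists_rep_tuple x
      refine Iff.trans Ultra.mk_mem_rel ?_
      symm
      apply relMap_quotient_mk'
  rw [h]
  exact Ultraproduct.sentence_realize ψ

namespace TSFormula

/-- Universal quantification over the variables `1, …, m`. -/
def allUpTo : ℕ → TSFormula L Ds → TSFormula L Ds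
  | 0, φ => φ
  | m + 1, φ => allUpTo m (.fa (m + 1) φ)

theorem sat_allUpTo {M : Type} [L.Structure M] (m : ℕ) (φ : TSFormula L Ds) (X : Set (ℕ → M)) :
    (allUpTo m φ).Sat M X ↔
      φ.Sat M {s' | ∃ s ∈ X, ∀ i, i = 0 ∨ m < i → s' i = s i} := by
  induction m generalizing φ with
  | zero =>
    have h : {s' : ℕ → M | ∃ s ∈ X, ∀ i, i = 0 ∨ 0 < i → s' i = s i} = X := by
      ext s'
      constructor
      · rintro ⟨s, hs, h⟩
        rwa [funext fun i => h i (Nat.eq_zero_or_pos i)]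
      · exact fun hs => ⟨s', hs, fun _ _ => rfl⟩
    rw [h, allUpTo]
  | succ m ih =>
    rw [allUpTo, ih, Sat]
    have h : {s' : ℕ → M | ∃ s ∈ {s' : ℕ → M | ∃ s ∈ X, ∀ i, i = 0 ∨ m < i → s' i = s i}, ∃ a : M,
        s' = Function.update s (m + 1) a} =
        {s' | ∃ s ∈ X, ∀ i, i = 0 ∨ m + 1 < i → s' i = s i} := by
      ext s'
      constructor
      · rintro ⟨s₁, ⟨s, hs, h⟩, a, rfl⟩
        refine ⟨s, hs, fun i hi => ?_⟩
        rw [Function.update_of_ne (by omega), h i (by omega)]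
      · rintro ⟨s, hs, h⟩
        refine ⟨Function.update s' (m + 1) (s (m + 1)), ⟨s, hs, fun i hi => ?_⟩, s' (m + 1), ?_⟩
        · rcases eq_or_ne i (m + 1) with rfl | hne
          · simp
          · rw [Function.update_of_ne hne, h i (by omega)]
        · simp
    rw [h]

theorem freeVars_allUpTo (m : ℕ) (φ : TSFormula L Ds) :
    (allUpTo m φ).freeVars = φ.freeVars \ Set.Icc 1 m := by
  induction m generalizing φ with
  | zero => simp [allUpTo]
  | succ m ih =>
    rw [allUpTo, ih, freeVars]
    ext i
    simp only [Set.mem_sdiff, Set.mem_singleton_iff, Set.mem_Icc]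
    grind

end TSFormula

/-- The slice of a `(k+1)`-ary relation at `v`. -/
def slice {k : ℕ} {M : Type} (T : Set (Fin (k + 1) → M)) (v : M) : Set (Fin k → M) :=
  {x | (Fin.cons v x : Fin (k + 1) → M) ∈ T}

namespace Dependency

variable {k : ℕ} (D : Dependency k)

/-- Some union of a nonempty family of slices of `T` belongs to `D`. -/
def HasSliceUnion (M : Type) (T : Set (Fin (k + 1) → M)) : Prop :=
  ∃ V : Set M, V.Nonempty ∧ D.Mem M (⋃ v ∈ V, slice T v)

/-- The formula `∃ v₀ ∀ v₁ … v_k (¬ T v₀ … v_k ∨ (T v₀ … v_k ∧ D v₁ … v_k))`. -/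
def sliceUnionFormula :
    TSFormula (relLang (k + 1)) (fun _ : Unit => (⟨k, D⟩ : (k : ℕ) × Dependency k)) :=
  .ex 0 (.allUpTo k
    (.disj (.nrel RelSymbol.rel fun i : Fin (k + 1) => .var (i : ℕ))
      (.conj (.rel RelSymbol.rel fun i : Fin (k + 1) => .var (i : ℕ))
        (.depAtom () fun i : Fin k => (i : ℕ) + 1))))

theorem freeVars_sliceUnionFormula : D.sliceUnionFormula.freeVars = ∅ := by
  simp only [sliceUnionFormula, TSFormula.freeVars, TSFormula.freeVars_allUpTo, termVars]
  ext i
  simp only [Set.mem_sdiff, Set.mem_union, Set.mem_iUnion, Set.mem_singleton_iff, Set.mem_range,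
    Set.mem_Icc, Set.mem_empty_iff_false, iff_false, not_and, not_not]
  rintro ⟨h, h'⟩
  have hi : i ≤ k := by
    rcases h with ⟨j, rfl⟩ | ⟨j, rfl⟩ | ⟨j, hj⟩
    · omega
    · omega
    · have := Fin.is_lt j
      change (j : ℕ) < k at this
      omega
  omega

theorem sat_sliceUnionFormula (M : Type) (T : Set (Fin (k + 1) → M)) (s : ℕ → M) :
    (letI := relStructure T; D.sliceUnionFormula.Sat M {s}) ↔ D.HasSliceUnion M T := by
  let _ := relStructure T
  have key : ∀ (V : Set M) (X : Set (ℕ → M)),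
      (X = {s' | ∃ s₁ ∈ {s' | ∃ s₁ ∈ ({s} : Set (ℕ → M)), ∃ m ∈ V,
        s' = Function.update s₁ 0 m}, ∀ i, i = 0 ∨ k < i → s' i = s₁ i}) →
      (teamMap {s' ∈ X | (fun i : Fin (k + 1) => s' i) ∈ T} (fun i : Fin k => (i : ℕ) + 1)) =
        ⋃ v ∈ V, slice T v := by
    rintro V X rfl
    ext x
    simp only [teamMap, slice, Set.mem_iUnion, Set.mem_ofPred_eq, Set.mem_singleton_iff,
      exists_eq_left, exists_prop]
    constructor
    · rintro ⟨s', ⟨⟨s₁, ⟨m, hm, rfl⟩, h⟩, hT⟩, rfl⟩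
      refine ⟨m, hm, ?_⟩
      convert hT using 1
      funext i
      refine Fin.cases ?_ (fun j => ?_) i
      · simpa using (h 0 (Or.inl rfl)).symm
      · simp
    · rintro ⟨v, hv, hT⟩
      refine ⟨fun i => if h : i < k + 1 then (Fin.cons v x : Fin (k + 1) → M) ⟨i, h⟩ else s i,
        ⟨⟨_, ⟨v, hv, rfl⟩, ?_⟩, ?_⟩, ?_⟩
      · rintro i (rfl | hi)
        · simp
        · have h1 : ¬ i < k + 1 := by omega
          have h2 : i ≠ 0 := by omega
          simp [h1, h2]
      · convert hT using 1
        funext i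
        exact dif_pos i.is_lt
      · funext j
        have hj : (j : ℕ) + 1 < k + 1 := Nat.succ_lt_succ j.is_lt
        simp only [hj, dite_true]
        rfl
  simp only [sliceUnionFormula, TSFormula.Sat, TSFormula.sat_allUpTo]
  constructor
  · rintro ⟨H, hH, Y, Z, hYZ, hY, hZ, hD⟩
    refine ⟨H s, hH s rfl, ?_⟩
    rw [← key (H s) (Y ∪ Z)]
    · convert hD using 2
      ext s'
      constructor
      · rintro ⟨hs | hs, hT⟩
        · exact absurd hT (hY s' hs)
        · exact hs
      · exact fun hs => ⟨Or.inr hs, hZ s' hs⟩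
    · rw [← hYZ]
      simp
  · rintro ⟨V, hV, hD⟩
    refine ⟨fun _ => V, fun _ _ => hV, ?_⟩
    generalize hX : {s' : ℕ → M | ∃ s₁ ∈ {s' | ∃ s₁ ∈ ({s} : Set (ℕ → M)), ∃ m ∈ V,
        s' = Function.update s₁ 0 m}, ∀ i, i = 0 ∨ k < i → s' i = s₁ i} = X
    refine ⟨{s' ∈ X | (fun i : Fin (k + 1) => s' i) ∉ T},
      {s' ∈ X | (fun i : Fin (k + 1) => s' i) ∈ T}, ?_, fun s' hs => hs.2, fun s' hs => hs.2, ?_⟩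
    · ext s'
      by_cases h : (fun i : Fin (k + 1) => s' i) ∈ T <;> simp [h]
    · rw [← key V X hX.symm] at hD
      exact hD

end Dependency

namespace StronglyFirstOrder

variable {k : ℕ} {D : Dependency k} {α : Type} {U : Ultrafilter α} {M : α → Type}
  [∀ a, Nonempty (M a)]

theorem hasSliceUnion_ultra (hsfo : StronglyFirstOrder D) (T : ∀ a, Set (Fin (k + 1) → M a)) :
    D.HasSliceUnion (Ultra U M) (Ultra.rel U T) ↔ ∀ᶠ a in U, D.HasSliceUnion (M a) (T a) := by
  obtain ⟨ψ, hψ⟩ := hsfo (relLang (k + 1)) D.sliceUnionFormula D.freeVars_sliceUnionFormula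
  have h : ∀ (A : Type) [Nonempty A] (T : Set (Fin (k + 1) → A)),
      (letI := relStructure T; Sentence.Realize A ψ) ↔ D.HasSliceUnion A T := by
    intro A _ T
    let _ := relStructure T
    rw [← hψ A]
    constructor
    · intro hs
      exact (D.sat_sliceUnionFormula A T _).1 (hs fun _ => Classical.arbitrary A)
    · exact fun hs s => (D.sat_sliceUnionFormula A T s).2 hs
  have : Nonempty (Ultra U M) := Ultraproduct.Product.instNonempty
  rw [← h, Ultra.realize_rel]
  simp only [h]

/-- Łoś's theorem for strongly first order dependencies. -/
theorem mem_ultra (hsfo : StronglyFirstOrder D) (R : ∀ a, Set (Fin k → M a)) :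
    D.Mem (Ultra U M) (Ultra.rel U R) ↔ ∀ᶠ a in U, D.Mem (M a) (R a) := by
  have h : ∀ (A : Type) [Nonempty A] (R : Set (Fin k → A)),
      D.HasSliceUnion A {u | (fun i : Fin k => u i.succ) ∈ R} ↔ D.Mem A R := by
    intro A _ R
    have hs : ∀ V : Set A, V.Nonempty →
        (⋃ v ∈ V, slice {u : Fin (k + 1) → A | (fun i : Fin k => u i.succ) ∈ R} v) = R := by
      rintro V ⟨v, hv⟩
      ext x
      simp only [slice, Set.mem_iUnion, Set.mem_ofPred_eq, Fin.cons_succ, exists_prop]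
      exact ⟨fun ⟨_, _, hx⟩ => hx, fun hx => ⟨v, hv, hx⟩⟩
    constructor
    · rintro ⟨V, hV, hD⟩
      rwa [hs V hV] at hD
    · exact fun hD => ⟨Set.univ, Set.univ_nonempty, by rwa [hs _ Set.univ_nonempty]⟩
  have : Nonempty (Ultra U M) := Ultraproduct.Product.instNonempty
  rw [← h]
  simp only [← h (M _)]
  exact hsfo.hasSliceUnion_ultra fun a => {u | (fun i : Fin k => u i.succ) ∈ R a}

end StronglyFirstOrder

namespace Ultra

variable {α : Type} {U : Ultrafilter α} {M N : α → Type} {k : ℕ}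

/-- The map between ultraproducts induced by a family of maps. -/
noncomputable def map (g : ∀ a, M a → N a) (x : Ultra U M) : Ultra U N :=
  mk U fun a => g a (x.rep a)

theorem map_mk (g : ∀ a, M a → N a) (f : ∀ a, M a) :
    map g (mk U f) = mk U fun a => g a (f a) := by
  have h : ∀ᶠ a in U, (mk U f).rep a = f a := mk_eq_mk.1 (mk_rep _)
  exact mk_eq_mk.2 (h.mono fun a ha => congrArg (g a) ha)

theorem map_injective {g : ∀ a, M a → N a} (hg : ∀ a, Function.Injective (g a)) :
    Function.Injective (map g : Ultra U M → Ultra U N) := by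
  intro x y hxy
  rw [← mk_rep x, ← mk_rep y]
  exact mk_eq_mk.2 ((mk_eq_mk.1 hxy).mono fun a ha => hg a ha)

theorem eventually_eq_iff (f g : ∀ a, M a) :
    ∀ᶠ a in U, (f a = g a ↔ mk U f = mk U g) := by
  by_cases h : mk U f = mk U g
  · exact (mk_eq_mk.1 h).mono fun a ha => iff_of_true ha h
  · exact (Ultrafilter.eventually_not.2 fun h' => h (mk_eq_mk.2 h')).mono
      fun a ha => iff_of_false ha h

theorem mk_eq_iff_mk_eq {f f' : ∀ a, M a} {g g' : ∀ a, N a}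
    (h : ∀ᶠ a in U, (f a = f' a ↔ g a = g' a)) : mk U f = mk U f' ↔ mk U g = mk U g' := by
  rw [mk_eq_mk, mk_eq_mk]
  exact Filter.eventually_congr h

theorem rel_mono {R S : ∀ a, Set (Fin k → M a)} (h : ∀ᶠ a in U, R a ⊆ S a) :
    rel U R ⊆ rel U S :=
  fun _ ht => ht.mp (h.mono fun _ ha hta => ha hta)

theorem rel_insert (s : ∀ a, Fin k → M a) (R : ∀ a, Set (Fin k → M a)) :
    rel U (fun a => insert (s a) (R a)) = insert (fun i => mk U fun a => s a i) (rel U R) := by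
  ext t
  obtain ⟨f, rfl⟩ := exists_rep_tuple t
  rw [mk_mem_rel, Set.mem_insert_iff, mk_mem_rel]
  simp only [Set.mem_insert_iff, Ultrafilter.eventually_or, funext_iff, mk_eq_mk,
    Filter.eventually_all]

theorem exists_tuple_of_eventually [∀ a, Nonempty (M a)] {P : ∀ a, (Fin k → M a) → Prop}
    (h : ∀ᶠ a in U, ∃ x, P a x) :
    ∃ f : Fin k → ∀ a, M a, ∀ᶠ a in U, P a fun i => f i a :=
  ⟨fun i a => Classical.epsilon (P a) i, h.mono fun _ ha => Classical.epsilon_spec ha⟩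

theorem rel_relImage [∀ a, Nonempty (M a)] (g : ∀ a, M a → N a) (R : ∀ a, Set (Fin k → M a)) :
    rel U (fun a => relImage (g a) (R a)) = relImage (map g) (rel U R) := by
  ext t
  constructor
  · intro ht
    obtain ⟨f, rfl⟩ := exists_rep_tuple t
    obtain ⟨r, hr⟩ := exists_tuple_of_eventually (mk_mem_rel.1 ht)
    refine ⟨fun i => mk U (r i), mk_mem_rel.2 (hr.mono fun a ha => ha.1), ?_⟩
    funext i
    simp only [map_mk]
    exact mk_eq_mk.2 (hr.mono fun a ha => congrFun ha.2 i)
  · rintro ⟨r, hr, rfl⟩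
    obtain ⟨f, rfl⟩ := exists_rep_tuple r
    simp only [map_mk]
    exact mk_mem_rel.2 ((mk_mem_rel.1 hr).mono fun a ha => ⟨_, ha, rfl⟩)

theorem slice_rel (T : ∀ a, Set (Fin (k + 1) → M a)) (v : ∀ a, M a) :
    slice (rel U T) (mk U v) = rel U fun a => slice (T a) (v a) := by
  ext x
  obtain ⟨f, rfl⟩ := exists_rep_tuple x
  have h : (Fin.cons (mk U v) fun i => mk U (f i) : Fin (k + 1) → Ultra U M) =
      fun i => mk U ((Fin.cons v f : Fin (k + 1) → ∀ a, M a) i) := by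
    funext i
    refine Fin.cases ?_ (fun j => ?_) i <;> simp
  rw [mk_mem_rel, slice, Set.mem_ofPred_eq, h, mk_mem_rel]
  refine Filter.eventually_congr (Filter.Eventually.of_forall fun a => ?_)
  rw [slice, Set.mem_ofPred_eq]
  have h' : (fun i => (Fin.cons v f : Fin (k + 1) → ∀ a, M a) i a) =
      (Fin.cons (v a) fun i => f i a : Fin (k + 1) → M a) := by
    funext i
    refine Fin.cases ?_ (fun j => ?_) i <;> simp
  rw [h']

end Ultra

/-- An ultrafilter on the finite subsets of `A` that contains all the sets `{C | C₀ ⊆ C}`. -/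
noncomputable def finsetUltrafilter (A : Type) : Ultrafilter (Finset A) :=
  letI := Classical.decEq A
  Ultrafilter.of Filter.atTop

theorem eventually_subset_finsetUltrafilter {A : Type} (C₀ : Finset A) :
    ∀ᶠ C in (finsetUltrafilter A : Filter (Finset A)), C₀ ⊆ C := by
  classical
  have h : ∀ᶠ C in Filter.atTop, C₀ ⊆ C := Filter.eventually_ge_atTop C₀
  convert! h.filter_mono (Ultrafilter.of_le _)

theorem eventually_mem_finsetUltrafilter {A : Type} (a : A) :
    ∀ᶠ C in (finsetUltrafilter A : Filter (Finset A)), a ∈ C :=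
  (eventually_subset_finsetUltrafilter {a}).mono fun _ h => h (Finset.mem_singleton_self a)

/-- The tuple `r` realizes the equality type of `s` over the finite set `C`, where the domain of
`r` is seen inside that of `s` through `g`. -/
def RealizesType {k : ℕ} {B E : Type} (g : B → E) (C : Finset B) (s : Fin k → E)
    (r : Fin k → B) : Prop :=
  (∀ i, ∀ a ∈ C, s i = g a ↔ r i = a) ∧ ∀ i j, s i = s j ↔ r i = r j

/-- A relation `R` in `D` that leaves `D` when a tuple `s` of an extension is added, although the
equality type of `s` is finitely satisfiable in `R`. -/
structure Dependency.IsJump {k : ℕ} (D : Dependency k) {B E : Type} (g : B → E)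
    (R : Set (Fin k → B)) (s : Fin k → E) : Prop where
  inj : Function.Injective g
  mem : D.Mem B R
  notMem : ¬ D.Mem E (insert s (relImage g R))
  fin : ∀ C : Finset B, ∃ r ∈ R, RealizesType g C s r

namespace Dependency

variable {k : ℕ} {D : Dependency k}

/-- A jump can be absorbed in an extension of the relation that still admits a jump. -/
theorem IsJump.exists_extension (hdi : D.DomainIndependent) (hsfo : StronglyFirstOrder D)
    {B E : Type} [Nonempty B] {g : B → E} {R : Set (Fin k → B)} {s : Fin k → E}
    (H : D.IsJump g R s) :
    ∃ (B' E' : Type) (g' : B' → E') (R' : Set (Fin k → B')) (s' : Fin k → E') (h : B → B')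
      (t : Fin k → B'), D.IsJump g' R' s' ∧ Function.Injective h ∧
      insert t (relImage h R) ⊆ R' ∧ ¬ D.Mem B' (insert t (relImage h R)) := by
  classical
  have : Nonempty E := ⟨g (Classical.arbitrary B)⟩
  let U := finsetUltrafilter B
  choose r hrR hr using H.fin
  let h : B → Ultra U (fun _ => B) := fun b => Ultra.mk U fun _ => b
  let t : Fin k → Ultra U (fun _ => B) := fun i => Ultra.mk U fun C => r C i
  let s' : Fin k → Ultra U (fun _ => E) := fun i => Ultra.mk U fun _ => s i
  have hinj : Function.Injective h := fun a b hab =>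
    let ⟨_, hC⟩ := (Ultra.mk_eq_mk.1 hab).exists
    hC
  have hconst : ∀ {X : Type} (x y : X),
      (Ultra.mk U (fun _ => x) : Ultra U fun _ => X) = Ultra.mk U (fun _ => y) ↔ x = y := by
    intro X x y
    rw [Ultra.mk_eq_mk, Filter.eventually_const]
  refine ⟨Ultra U fun _ => B, Ultra U fun _ => E, Ultra.map fun _ => g, Ultra.rel U fun _ => R,
    s', h, t, ⟨Ultra.map_injective fun _ => H.inj, ?_, ?_, ?_⟩, hinj, ?_, ?_⟩
  · rw [hsfo.mem_ultra]
    exact Filter.Eventually.of_forall fun _ => H.mem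
  · rw [← Ultra.rel_relImage, ← Ultra.rel_insert (U := U) (fun _ => s), hsfo.mem_ultra,
      Filter.eventually_const]
    exact H.notMem
  · intro C'
    choose q hqR hq using fun C : Finset B => H.fin (C'.image fun x => x.rep C)
    refine ⟨fun i => Ultra.mk U fun C => q C i,
      Ultra.mk_mem_rel.2 (Filter.Eventually.of_forall hqR), fun i x hx => ?_, fun i j => ?_⟩
    · conv_rhs => rw [← Ultra.mk_rep x]
      exact Ultra.mk_eq_iff_mk_eq (Filter.Eventually.of_forall fun C =>
        (hq C).1 i _ (Finset.mem_image_of_mem _ hx))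
    · exact Ultra.mk_eq_iff_mk_eq (Filter.Eventually.of_forall fun C => (hq C).2 i j)
  · rintro x (rfl | ⟨y, hy, rfl⟩)
    · exact Ultra.mk_mem_rel.2 (Filter.Eventually.of_forall hrR)
    · exact Ultra.mk_mem_rel.2 (Filter.Eventually.of_forall fun _ => hy)
  · rw [← hdi.mem_insert_congr H.inj hinj (s := s)]
    · exact H.notMem
    · intro i a
      rw [← hconst (s i) (g a)]
      exact Ultra.mk_eq_iff_mk_eq ((eventually_mem_finsetUltrafilter a).mono fun C hC =>
        (hr C).1 i a hC)
    · intro i j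
      rw [← hconst (s i) (s j)]
      exact Ultra.mk_eq_iff_mk_eq (Filter.Eventually.of_forall fun C => (hr C).2 i j)

/-- From a jump one obtains, for every `n`, a chain of length `n` of relations alternately in `D`
and not in `D`. -/
theorem IsJump.exists_chain (hdi : D.DomainIndependent) (hsfo : StronglyFirstOrder D)
    {B₀ E₀ : Type} [Nonempty B₀] {g₀ : B₀ → E₀} {R₀ : Set (Fin k → B₀)} {s₀ : Fin k → E₀}
    (H : D.IsJump g₀ R₀ s₀) (n : ℕ) :
    ∃ (B E : Type) (g : B → E) (s : Fin k → E) (R S : ℕ → Set (Fin k → B)),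
      Nonempty B ∧ D.IsJump g (R n) s ∧
      ∀ i < n, D.Mem B (R i) ∧ ¬ D.Mem B (S i) ∧ R i ⊆ S i ∧ S i ⊆ R (i + 1) := by
  induction n with
  | zero => exact ⟨B₀, E₀, g₀, s₀, fun _ => R₀, fun _ => R₀, inferInstance, H, by simp⟩
  | succ n ih =>
    obtain ⟨B, E, g, s, R, S, hB, hJ, hRS⟩ := ih
    obtain ⟨B', E', g', R', s', h, t, hJ', hh, hsub, hnot⟩ := hJ.exists_extension hdi hsfo
    refine ⟨B', E', g', s', fun i => if i ≤ n then relImage h (R i) else R',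
      fun i => if i < n then relImage h (S i) else insert t (relImage h (R n)),
      hB.map h, by simpa using hJ', fun i hi => ?_⟩
    rcases Nat.lt_succ_iff_lt_or_eq.1 hi with hi | rfl
    · obtain ⟨h1, h2, h3, h4⟩ := hRS i hi
      simp only [hi, hi.le, Nat.succ_le_of_lt hi, if_true, hdi.mem_relImage hh]
      exact ⟨h1, h2, relImage_mono h h3, relImage_mono h h4⟩
    · simp only [le_refl, lt_irrefl, if_true, if_false, hdi.mem_relImage hh,
        Nat.not_succ_le_self]
      exact ⟨hJ.mem, hnot, Set.subset_insert _ _, hsub⟩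

/-- Union closed, domain independent, strongly first order dependencies admit no jumps. -/
theorem not_isJump (hdi : D.DomainIndependent) (hsfo : StronglyFirstOrder D)
    (huc : D.UnionClosed) {B₀ E₀ : Type} [Nonempty B₀] {g₀ : B₀ → E₀}
    {R₀ : Set (Fin k → B₀)} {s₀ : Fin k → E₀} : ¬ D.IsJump g₀ R₀ s₀ := by
  intro H
  choose B _ _ _ R S hB _ hRS using fun n => H.exists_chain hdi hsfo (n + 1)
  let U : Ultrafilter ℕ := Filter.hyperfilter ℕ
  let M : ℕ → Type := fun n => B n ⊕ ℕ
  let idx : ∀ n, M n → ℕ := fun n => Sum.elim (fun _ => 0) fun i => min i n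
  have hidx : ∀ n v, idx n v ≤ n := by
    rintro n (v | v) <;> simp [idx]
  let T : ∀ n, Set (Fin (k + 1) → M n) := fun n =>
    {u | (fun i : Fin k => u i.succ) ∈ relImage Sum.inl (S n (idx n (u 0)))}
  have hT : ∀ n v, slice (T n) v = relImage Sum.inl (S n (idx n v)) := fun n v => rfl
  have hmono : ∀ n i j, i ≤ j → j ≤ n → S n i ⊆ S n j := by
    intro n i j hij
    induction j, hij using Nat.le_induction with
    | base => exact fun _ => subset_rfl
    | succ j _ ih =>
      intro hj
      exact (ih (by omega)).trans <|
        (hRS n j (by omega)).2.2.2.trans (hRS n (j + 1) (by omega)).2.2.1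
  have hfin : ∀ n, ¬ D.HasSliceUnion (M n) (T n) := by
    rintro n ⟨V, hV, hD⟩
    have hbdd : BddAbove (idx n '' V) := ⟨n, by rintro _ ⟨v, _, rfl⟩; exact hidx n v⟩
    obtain ⟨v, hv, hmax⟩ := Nat.sSup_mem (hV.image (idx n)) hbdd
    have hU : (⋃ v ∈ V, slice (T n) v) = relImage Sum.inl (S n (idx n v)) := by
      apply Set.Subset.antisymm
      · refine Set.iUnion₂_subset fun w hw => ?_
        rw [hT]
        refine relImage_mono _ (hmono n _ _ ?_ (hidx n v))
        rw [hmax]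
        exact le_csSup hbdd ⟨w, hw, rfl⟩
      · exact Set.subset_iUnion₂_of_subset v hv (hT n v).ge
    rw [hU, hdi.mem_relImage Sum.inl_injective] at hD
    exact (hRS n _ (Nat.lt_succ_of_le (hidx n v))).2.1 hD
  have hinf : D.HasSliceUnion (Ultra U M) (Ultra.rel U T) := by
    let R' : ℕ → Set (Fin k → Ultra U M) := fun i =>
      Ultra.rel U fun n => relImage Sum.inl (R n i)
    let S' : ℕ → Set (Fin k → Ultra U M) := fun i =>
      slice (Ultra.rel U T) (Ultra.mk U fun _ => Sum.inr i)
    have hlarge : ∀ i, ∀ᶠ n in (U : Filter ℕ), i ≤ n := fun i =>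
      (Filter.eventually_ge_atTop i).filter_mono Nat.hyperfilter_le_atTop
    have hS' : ∀ i, S' i = Ultra.rel U fun n => relImage Sum.inl (S n (min i n)) := fun i => by
      simp only [S', Ultra.slice_rel, hT]
      rfl
    have hR'S' : ∀ i, R' i ⊆ S' i := fun i => by
      rw [hS']
      refine Ultra.rel_mono ((hlarge i).mono fun n hn => relImage_mono _ ?_)
      rw [min_eq_left hn]
      exact (hRS n i (by omega)).2.2.1
    have hS'R' : ∀ i, S' i ⊆ R' (i + 1) := fun i => by
      rw [hS']
      refine Ultra.rel_mono ((hlarge i).mono fun n hn => relImage_mono _ ?_)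
      rw [min_eq_left hn]
      exact (hRS n i (by omega)).2.2.2
    have hR' : ∀ i, D.Mem (Ultra U M) (R' i) := fun i => by
      rw [hsfo.mem_ultra]
      refine (hlarge i).mono fun n hn => ?_
      rw [hdi.mem_relImage Sum.inl_injective]
      exact (hRS n i (by omega)).1
    refine ⟨Set.range fun i : ℕ => Ultra.mk U fun _ => Sum.inr i, Set.range_nonempty _, ?_⟩
    rw [Set.biUnion_range]
    refine huc.mem_of_forall_exists fun x hx => ?_
    obtain ⟨i, hi⟩ := Set.mem_iUnion.1 hx
    exact ⟨R' (i + 1), (hR'S' (i + 1)).trans (Set.subset_iUnion S' (i + 1)), hS'R' i hi, hR' _⟩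
  obtain ⟨n, hn⟩ := ((hsfo.hasSliceUnion_ultra T).1 hinf).exists
  exact hfin n hn

end Dependency

/-- For every finite set `C` of elements, a U-sentence describing the relation `R` from the point
of view of `C`. -/
theorem exists_uSentence {k : ℕ} {A : Type} (R : Set (Fin k → A)) (C : Finset A) :
    ∃ χ : USentence k 0, USentence.Realize A R Fin.elim0 χ ∧
      ∀ (B : Type), Nonempty B → ∀ S : Set (Fin k → B), USentence.Realize B S Fin.elim0 χ →
        ∃ g : A → B, Set.InjOn g C ∧ (∀ r ∈ R, (∀ i, r i ∈ C) → (fun i => g (r i)) ∈ S) ∧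
          ∀ y ∈ S, ∃ r ∈ R, RealizesType g C y r := by
  classical
  let e := C.equivFin
  let c : Fin C.card → A := fun i => e.symm i
  have hc : Function.Injective c := fun i j h => e.symm.injective (Subtype.ext h)
  have hce : ∀ a (ha : a ∈ C), c (e ⟨a, ha⟩) = a := fun a ha => by simp [c]
  let P := (Fin C.card ⊕ Fin k) × (Fin C.card ⊕ Fin k)
  let θ : (constLang 0).Formula (Fin C.card ⊕ Fin k) :=
    Formula.iSup fun K : {K : Set P // ∃ r ∈ R, K = {p | Sum.elim c r p.1 = Sum.elim c r p.2}} =>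
      Formula.iInf fun p : P => if p ∈ K.1 then Term.equal (Term.var p.1) (Term.var p.2)
        else (Term.equal (Term.var p.1) (Term.var p.2)).not
  have hθ : ∀ (B : Type) (z : Fin C.card ⊕ Fin k → B),
      (letI := constStructure B Fin.elim0; θ.Realize z) ↔
        ∃ r ∈ R, ∀ a b, z a = z b ↔ Sum.elim c r a = Sum.elim c r b := by
    intro B z
    let _ := constStructure B Fin.elim0
    have hlit : ∀ (K : Set P) (p : P), (if p ∈ K then Term.equal (Term.var p.1) (Term.var p.2)
        else (Term.equal (Term.var p.1) (Term.var p.2)).not : (constLang 0).Formula _).Realize z ↔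
        (z p.1 = z p.2 ↔ p ∈ K) := by
      intro K p
      by_cases hp : p ∈ K <;> simp [hp, Formula.realize_equal, Formula.realize_not]
    simp only [θ, Formula.realize_iSup, Formula.realize_iInf, hlit]
    constructor
    · rintro ⟨⟨K, r, hr, rfl⟩, h⟩
      exact ⟨r, hr, fun a b => h (a, b)⟩
    · rintro ⟨r, hr, h⟩
      exact ⟨⟨_, r, hr, rfl⟩, fun p => h p.1 p.2⟩
  let neLits : List (ULit k 0 C.card) :=
    (Finset.univ.filter fun p : Fin C.card × Fin C.card => p.1 ≠ p.2).toList.map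
      fun p => .ne (.inl p.1) (.inl p.2)
  let relLits : List (ULit k 0 C.card) :=
    (Finset.univ.filter fun τ : Fin k → Fin C.card => (fun i => c (τ i)) ∈ R).toList.map
      fun τ => .rel fun i => .inl (τ i)
  refine ⟨⟨C.card, neLits ++ relLits, θ⟩, ⟨c, ?_, ?_⟩, ?_⟩
  · intro l hl
    rcases List.mem_append.1 hl with hl | hl
    · obtain ⟨p, hp, rfl⟩ := List.mem_map.1 hl
      simp only [Finset.mem_toList, Finset.mem_filter, Finset.mem_univ, true_and] at hp
      exact hc.ne hp
    · obtain ⟨τ, hτ, rfl⟩ := List.mem_map.1 hl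
      simp only [Finset.mem_toList, Finset.mem_filter, Finset.mem_univ, true_and] at hτ
      exact hτ
  · intro y hy
    exact (hθ A _).2 ⟨y, hy, fun _ _ => Iff.rfl⟩
  · rintro B ⟨b₀⟩ S ⟨x, hη, hx⟩
    change Fin C.card → B at x
    have hxinj : Function.Injective x := by
      intro i j hij
      by_contra hne
      refine hη (.ne (.inl i) (.inl j)) (List.mem_append_left _ (List.mem_map.2 ⟨(i, j), ?_, rfl⟩))
        hij
      simpa using hne
    let g : A → B := fun a => if ha : a ∈ C then x (e ⟨a, ha⟩) else b₀
    have hg : ∀ a (ha : a ∈ C), g a = x (e ⟨a, ha⟩) := fun a ha => dif_pos ha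
    refine ⟨g, ?_, ?_, ?_⟩
    · intro a ha b hb hab
      rw [hg a ha, hg b hb] at hab
      exact congrArg Subtype.val (e.injective (hxinj hab))
    · intro r hr hrC
      have hlit := hη (.rel fun i => .inl (e ⟨r i, hrC i⟩))
        (List.mem_append_right _ (List.mem_map.2 ⟨fun i => e ⟨r i, hrC i⟩, by simpa [hce], rfl⟩))
      simp only [hg _ (hrC _)]
      exact hlit
    · intro y hy
      obtain ⟨r, hr, h⟩ := (hθ B _).1 (hx y hy)
      refine ⟨r, hr, fun i a ha => ?_, fun i j => h (.inr i) (.inr j)⟩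
      have := h (.inr i) (.inl (e ⟨a, ha⟩))
      simpa only [Sum.elim_inl, Sum.elim_inr, hce, ← hg] using this

/-- **Local characterization.** Let `D` be a domain independent, strongly first order,
union closed dependency with `(A, R) ∈ D`. Then there is a U-sentence `χ(R)` over the
signature `{R}` (no constants) such that `(A, R) ⊨ χ(R)` and `χ(R) ⊨ D(R)`, i.e. every
model of `χ` is in `D`. -/
theorem local_characterization {k : ℕ} (D : Dependency k)
    (hdi : D.DomainIndependent) (hsfo : StronglyFirstOrder D) (huc : D.UnionClosed)
    (A : Type) (hne : Nonempty A) (R : Set (Fin k → A)) (hR : D.Mem A R) :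
    ∃ χ : USentence k 0,
      USentence.Realize A R Fin.elim0 χ ∧
      ∀ (B : Type), Nonempty B → ∀ S : Set (Fin k → B),
        USentence.Realize B S Fin.elim0 χ → D.Mem B S := by
  classical
  by_contra hcon
  have hbad : ∀ C : Finset A, ∃ (B : Type) (g : A → B) (S : Set (Fin k → B)), Nonempty B ∧
      ¬ D.Mem B S ∧ Set.InjOn g C ∧ (∀ r ∈ R, (∀ i, r i ∈ C) → (fun i => g (r i)) ∈ S) ∧
      ∀ y ∈ S, ∃ r ∈ R, RealizesType g C y r := by
    intro C
    obtain ⟨χ, hχ, hχ'⟩ := exists_uSentence R C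
    by_contra! hC
    refine hcon ⟨χ, hχ, fun B hB S hS => ?_⟩
    obtain ⟨g, hg, hgR, hgS⟩ := hχ' B hB S hS
    by_contra hD
    obtain ⟨y, hy, hy'⟩ := hC B g S hB hD hg hgR
    obtain ⟨r, hr, hyr⟩ := hgS y hy
    exact hy' r hr hyr
  choose B g S hB hS hginj hgR hgS using hbad
  let U := finsetUltrafilter A
  let g' : A → Ultra U B := fun a => Ultra.mk U fun C => g C a
  let S' : Set (Fin k → Ultra U B) := Ultra.rel U S
  have hg' : Function.Injective g' := by
    intro a b hab
    obtain ⟨C, hC, ha, hb⟩ := ((Ultra.mk_eq_mk.1 hab).and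
      ((eventually_mem_finsetUltrafilter a).and (eventually_mem_finsetUltrafilter b))).exists
    exact hginj C ha hb hC
  have hS' : ¬ D.Mem (Ultra U B) S' := by
    rw [hsfo.mem_ultra]
    intro h
    obtain ⟨C, hC⟩ := h.exists
    exact hS C hC
  have hsub : relImage g' R ⊆ S' := by
    rintro _ ⟨r, hr, rfl⟩
    refine Ultra.mk_mem_rel.2 ?_
    refine (Filter.eventually_all.2 fun i => eventually_mem_finsetUltrafilter (r i)).mono ?_
    exact fun C hC => hgR C r hr hC
  obtain ⟨s, hs, hsD⟩ : ∃ s ∈ S', ¬ D.Mem (Ultra U B) (insert s (relImage g' R)) := by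
    by_contra! h
    exact hS' (huc.mem_of_forall_exists fun s hs =>
      ⟨_, Set.insert_subset hs hsub, Set.mem_insert _ _, h s hs⟩)
  refine Dependency.not_isJump hdi hsfo huc ⟨hg', hR, hsD, fun C₀ => ?_⟩
  obtain ⟨f, rfl⟩ := Ultra.exists_rep_tuple s
  obtain ⟨C, hfS, hC, h1, h2⟩ := ((Ultra.mk_mem_rel.1 hs).and
    ((eventually_subset_finsetUltrafilter C₀).and
      ((Filter.eventually_all.2 fun i => (Filter.eventually_all_finset C₀).2 fun a _ =>
        Ultra.eventually_eq_iff (f i) fun C => g C a).and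
      (Filter.eventually_all.2 fun i => Filter.eventually_all.2 fun j =>
        Ultra.eventually_eq_iff (f i) (f j))))).exists
  obtain ⟨r, hr, hr1, hr2⟩ := hgS C _ hfS
  exact ⟨r, hr, fun i a ha => (h1 i a ha).symm.trans (hr1 i a (hC ha)),
    fun i j => (h2 i j).symm.trans (hr2 i j)⟩
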